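/- Let {k_u} be a degree sequence on a finite vertex set V of size n with k_u ≥ 1 for every u, and suppose there are at least two distinct multiloop-graphs on V with degree sequence {k_u}. Then the graph of multiloop-graphs G_ll({k_u}) is connected if and only if both of the following hold: (1) there exists a vertex u with k_u odd; and (2) there exists a vertex v with k_v − (n−1) either negative or odd. -/

import Mathlib

/-!
Multiset-based graphs: a graph on `V` is a multiset of unordered pairs (`Sym2 V`).
-/

variable {V : Type*}

/-- Degree of `u`: number of edge-endpoints at `u` (a self-loop at `u` contributes 2). -/
def mDeg [DecidableEq V] (E : Multiset (Sym2 V)) (u : V) : ℕ :=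
  (E.map fun e => if e = s(u, u) then 2 else if u ∈ e then 1 else 0).sum

/-- Loopy-multigraph: every self-loop occurs with multiplicity at most 1
(non-loop pairs may repeat). -/
def IsLoopyMultigraph [DecidableEq V] (E : Multiset (Sym2 V)) : Prop :=
  ∀ u : V, E.count s(u, u) ≤ 1

/-- Multiloop-graph: every non-loop pair occurs with multiplicity at most 1
(self-loops may repeat). -/
def IsMultiloopGraph [DecidableEq V] (E : Multiset (Sym2 V)) : Prop :=
  ∀ u v : V, u ≠ v → E.count s(u, v) ≤ 1

/-- Double edge swap: remove edges `(u,v)`, `(x,y)` (counted with multiplicity),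
add the edges `(u,x)`, `(v,y)`. -/
def DoubleEdgeSwap [DecidableEq V] (E E' : Multiset (Sym2 V)) : Prop :=
  ∃ u v x y : V, ({s(u, v), s(x, y)} : Multiset (Sym2 V)) ≤ E ∧
    E' = E - {s(u, v), s(x, y)} + {s(u, x), s(v, y)}

/-- Adjacency in the graph of graphs on the space of graphs satisfying `P`:
both graphs lie in the space and one is obtained from the other by a single double edge swap. -/
def GogAdj [DecidableEq V] (P : Multiset (Sym2 V) → Prop) (E E' : Multiset (Sym2 V)) : Prop :=
  P E ∧ P E' ∧ (DoubleEdgeSwap E E' ∨ DoubleEdgeSwap E' E)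

/-- The space of loopy-multigraphs with degree sequence `k`. -/
def LMGspace [DecidableEq V] (k : V → ℕ) (E : Multiset (Sym2 V)) : Prop :=
  IsLoopyMultigraph E ∧ ∀ u, mDeg E u = k u

/-- The space of multiloop-graphs with degree sequence `k`. -/
def MLGspace [DecidableEq V] (k : V → ℕ) (E : Multiset (Sym2 V)) : Prop :=
  IsMultiloopGraph E ∧ ∀ u, mDeg E u = k u

/-- Number of self-loops of `E` (counted with multiplicity). -/
def loopCount [DecidableEq V] (E : Multiset (Sym2 V)) : ℕ :=
  (E.filter fun e => e.IsDiag).card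

/-- An open wedge: non-loop edges `(u,v)`, `(u,x)` with `v ≠ x` such that `(v,x)` is not
an edge. -/
def HasOpenWedge [DecidableEq V] (E : Multiset (Sym2 V)) : Prop :=
  ∃ u v x : V, u ≠ v ∧ u ≠ x ∧ v ≠ x ∧ s(u, v) ∈ E ∧ s(u, x) ∈ E ∧ s(v, x) ∉ E

section Degrees

variable [DecidableEq V]

theorem mDeg_add (E F : Multiset (Sym2 V)) (u : V) : mDeg (E + F) u = mDeg E u + mDeg F u := by
  simp [mDeg]

theorem mDeg_pair (a b c d u : V) :
    mDeg ({s(a, b), s(c, d)} : Multiset (Sym2 V)) u =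
      (if a = u then 1 else 0) + (if b = u then 1 else 0) +
        ((if c = u then 1 else 0) + (if d = u then 1 else 0)) := by
  have h : ∀ a b : V, (if s(a, b) = s(u, u) then 2 else if u ∈ s(a, b) then 1 else 0) =
      (if a = u then 1 else 0) + (if b = u then 1 else 0) := by
    intro a b
    simp only [Sym2.eq_iff, Sym2.mem_iff]
    grind
  simp only [mDeg, Multiset.insert_eq_cons, Multiset.map_cons, Multiset.map_singleton,
    Multiset.sum_cons, Multiset.sum_singleton, h]

theorem mDeg_eq_sum_count [Fintype V] (E : Multiset (Sym2 V)) (u : V) :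
    mDeg E u = ∑ v, E.count s(u, v) + E.count s(u, u) := by
  induction E using Multiset.induction_on with
  | empty => simp [mDeg]
  | cons e E ih =>
    have h : mDeg (e ::ₘ E) u =
        (if e = s(u, u) then 2 else if u ∈ e then 1 else 0) + mDeg E u := by simp [mDeg]
    have hs : (∑ v, if s(u, v) = e then 1 else 0) = if u ∈ e then 1 else 0 := by
      split_ifs with hu
      · obtain ⟨w, rfl⟩ := hu
        simp only [Sym2.congr_right, Finset.sum_ite_eq', Finset.mem_univ, if_true]
      · refine Finset.sum_eq_zero fun v _ => if_neg ?_
        rintro rfl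
        exact hu (Sym2.mem_mk_left u v)
    simp only [h, ih, Multiset.count_cons, Finset.sum_add_distrib, hs]
    by_cases he : e = s(u, u)
    · subst he
      simp
      ring
    · simp only [he, Ne.symm he, if_false]
      ring

/-- The neighbours of `u` along non-loop edges of `E`. -/
def nonloopNeighbors [Fintype V] (E : Multiset (Sym2 V)) (u : V) : Finset V :=
  Finset.univ.filter fun v => v ≠ u ∧ s(u, v) ∈ E

@[simp]
theorem mem_nonloopNeighbors [Fintype V] {E : Multiset (Sym2 V)} {u v : V} :
    v ∈ nonloopNeighbors E u ↔ v ≠ u ∧ s(u, v) ∈ E := by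
  simp [nonloopNeighbors]

theorem IsMultiloopGraph.mDeg_eq [Fintype V] {E : Multiset (Sym2 V)} (hE : IsMultiloopGraph E)
    (u : V) : mDeg E u = 2 * E.count s(u, u) + (nonloopNeighbors E u).card := by
  rw [mDeg_eq_sum_count, ← Finset.add_sum_erase _ _ (Finset.mem_univ u)]
  have h : ∑ v ∈ Finset.univ.erase u, E.count s(u, v) = (nonloopNeighbors E u).card := by
    rw [Finset.card_eq_sum_ones, nonloopNeighbors, Finset.sum_filter,
      ← Finset.sum_erase (a := u) Finset.univ (by simp)]
    refine Finset.sum_congr rfl fun v hv => ?_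
    have hv : v ≠ u := Finset.ne_of_mem_erase hv
    have h1 := hE u v hv.symm
    by_cases hm : s(u, v) ∈ E
    · have := Multiset.one_le_count_iff_mem.2 hm
      simp [hv, hm]
      omega
    · simp [hm]
  rw [h]
  ring

/-- Number of non-loop edges. -/
def nonloopCount (E : Multiset (Sym2 V)) : ℕ :=
  E.countP fun e => ¬ e.IsDiag

end Degrees

section Moves

variable [DecidableEq V]

theorem DoubleEdgeSwap.symm {E E' : Multiset (Sym2 V)} (h : DoubleEdgeSwap E E') :
    DoubleEdgeSwap E' E := by
  obtain ⟨u, v, x, y, hle, rfl⟩ := h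
  refine ⟨u, x, v, y, Multiset.le_add_left _ _, ?_⟩
  rw [add_tsub_cancel_right, tsub_add_cancel_of_le hle]

theorem GogAdj.symm {P : Multiset (Sym2 V) → Prop} {E E' : Multiset (Sym2 V)}
    (h : GogAdj P E E') : GogAdj P E' E :=
  ⟨h.2.1, h.1, h.2.2.symm⟩

theorem GogAdj.doubleEdgeSwap {P : Multiset (Sym2 V) → Prop} {E E' : Multiset (Sym2 V)}
    (h : GogAdj P E E') : DoubleEdgeSwap E E' :=
  h.2.2.elim id DoubleEdgeSwap.symm

theorem IsMultiloopGraph.count_le_one {E : Multiset (Sym2 V)} (hE : IsMultiloopGraph E)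
    {e : Sym2 V} (he : ¬ e.IsDiag) : E.count e ≤ 1 := by
  induction e with
  | h a b => exact hE a b he

theorem exists_gogAdj_of_swap {k : V → ℕ} {E : Multiset (Sym2 V)} (hE : MLGspace k E)
    {u v x y : V} (hle : ({s(u, v), s(x, y)} : Multiset (Sym2 V)) ≤ E)
    (hux : u ≠ x → s(u, x) ∉ E) (hvy : v ≠ y → s(v, y) ∉ E)
    (hne : u ≠ x → s(u, x) ≠ s(v, y)) :
    ∃ E', GogAdj (MLGspace k) E E' ∧
      nonloopCount E' + nonloopCount ({s(u, v), s(x, y)} : Multiset (Sym2 V)) =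
        nonloopCount E + nonloopCount ({s(u, x), s(v, y)} : Multiset (Sym2 V)) ∧
      ∀ a b, a ≠ b → (s(a, b) ∈ E' ↔ (s(a, b) ∈ E ∧ s(a, b) ≠ s(u, v) ∧ s(a, b) ≠ s(x, y)) ∨
        s(a, b) = s(u, x) ∨ s(a, b) = s(v, y)) := by
  obtain ⟨R, rfl⟩ := Multiset.le_iff_exists_add.1 hle
  have hcount : ∀ e p q : Sym2 V, ({p, q} : Multiset (Sym2 V)).count e =
      (if e = p then 1 else 0) + (if e = q then 1 else 0) := by
    intro e p q
    simp [Multiset.insert_eq_cons, Multiset.count_cons, Multiset.count_singleton, add_comm]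
  have hmul : IsMultiloopGraph (R + {s(u, x), s(v, y)}) := by
    intro a b hab
    have h1 := hE.1 a b hab
    rw [Multiset.count_add, hcount] at h1 ⊢
    have hR : s(a, b) ∉ R → R.count s(a, b) = 0 := Multiset.count_eq_zero_of_notMem
    by_cases hp : s(a, b) = s(u, x)
    · have hux' : u ≠ x := by
        rintro rfl
        simp only [Sym2.eq_iff] at hp
        grind
      have := hux hux'
      have := hne hux'
      rw [← hp] at *
      simp_all
    · by_cases hq : s(a, b) = s(v, y)
      · have hvy' : v ≠ y := by
          rintro rfl
          simp only [Sym2.eq_iff] at hq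
          grind
        have := hvy hvy'
        rw [← hq] at *
        simp_all
      · simp only [hp, hq, if_false]
        omega
  refine ⟨R + {s(u, x), s(v, y)}, ⟨hE, ⟨hmul, fun w => ?_⟩, Or.inl ⟨u, v, x, y, hle, ?_⟩⟩, ?_, ?_⟩
  · rw [← hE.2 w, mDeg_add, mDeg_add, mDeg_pair, mDeg_pair]
    ring
  · rw [add_tsub_cancel_left]
  · simp only [nonloopCount, Multiset.countP_add]
    ring
  · intro a b hab
    have h1 := hE.1 a b hab
    rw [Multiset.count_add, hcount] at h1
    have h2 : s(a, b) ∈ R → 1 ≤ R.count s(a, b) := Multiset.one_le_count_iff_mem.2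
    simp only [Multiset.mem_add, Multiset.insert_eq_cons, Multiset.mem_cons,
      Multiset.mem_singleton]
    grind

theorem pair_le_of_mem {α : Type*} [DecidableEq α] {E : Multiset α} {p q : α} (hp : p ∈ E)
    (hq : q ∈ E) (hpq : p ≠ q) : ({p, q} : Multiset α) ≤ E := by
  rw [Multiset.le_iff_subset (by simp [hpq])]
  intro e he
  simp only [Multiset.insert_eq_cons, Multiset.mem_cons, Multiset.mem_singleton] at he
  rcases he with rfl | rfl <;> assumption

theorem nonloopCount_pair (a b c d : V) :
    nonloopCount ({s(a, b), s(c, d)} : Multiset (Sym2 V)) =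
      (if a = b then 0 else 1) + (if c = d then 0 else 1) := by
  simp only [nonloopCount, Multiset.insert_eq_cons, Multiset.countP_cons,
    ← Multiset.cons_zero, Multiset.countP_zero, Sym2.mk_isDiag_iff]
  split_ifs <;> simp_all

/-- An open wedge can be closed, turning its centre into a loop. -/
theorem exists_gogAdj_close_wedge {k : V → ℕ} {E : Multiset (Sym2 V)} (hE : MLGspace k E)
    {u v x : V} (huv : u ≠ v) (hux : u ≠ x) (hvx : v ≠ x) (h1 : s(u, v) ∈ E) (h2 : s(u, x) ∈ E)
    (h3 : s(v, x) ∉ E) :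
    ∃ E', GogAdj (MLGspace k) E E' ∧ nonloopCount E' + 1 = nonloopCount E ∧
      ∀ a b, a ≠ b → (s(a, b) ∈ E' ↔ (s(a, b) ∈ E ∧ s(a, b) ≠ s(u, v) ∧ s(a, b) ≠ s(u, x)) ∨
        s(a, b) = s(v, x)) := by
  obtain ⟨E', hadj, hN, hmem⟩ := exists_gogAdj_of_swap hE
    (pair_le_of_mem h1 h2 (mt Sym2.congr_right.1 hvx)) (fun h => absurd rfl h) (fun _ => h3)
    (fun h => absurd rfl h)
  refine ⟨E', hadj, ?_, fun a b hab => ?_⟩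
  · simp only [nonloopCount_pair, huv, hux, hvx, if_true, if_false] at hN
    omega
  · rw [hmem a b hab]
    have : s(a, b) ≠ s(u, u) := by
      simp only [ne_eq, Sym2.eq_iff]
      grind
    simp [this]

/-- A loop at `u` and an edge `xy` may be replaced by the wedge `xuy`. -/
theorem exists_gogAdj_open_loop {k : V → ℕ} {E : Multiset (Sym2 V)} (hE : MLGspace k E)
    {u x y : V} (hux : u ≠ x) (huy : u ≠ y) (hxy : x ≠ y) (h1 : s(u, u) ∈ E) (h2 : s(x, y) ∈ E)
    (h3 : s(u, x) ∉ E) (h4 : s(u, y) ∉ E) :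
    ∃ E', GogAdj (MLGspace k) E E' ∧ nonloopCount E' = nonloopCount E + 1 ∧
      ∀ a b, a ≠ b → (s(a, b) ∈ E' ↔ (s(a, b) ∈ E ∧ s(a, b) ≠ s(x, y)) ∨
        s(a, b) = s(u, x) ∨ s(a, b) = s(u, y)) := by
  obtain ⟨E', hadj, hN, hmem⟩ := exists_gogAdj_of_swap hE
    (pair_le_of_mem h1 h2 (by simp only [ne_eq, Sym2.eq_iff]; grind)) (fun _ => h3) (fun _ => h4)
    (by simp only [ne_eq, Sym2.eq_iff]; grind)
  refine ⟨E', hadj, ?_, fun a b hab => ?_⟩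
  · simp only [nonloopCount_pair, huy, hux, hxy, if_true, if_false] at hN
    omega
  · rw [hmem a b hab]
    have : s(a, b) ≠ s(u, u) := by
      simp only [ne_eq, Sym2.eq_iff]
      grind
    simp [this]

/-- The swap of two disjoint non-loop edges. -/
theorem exists_gogAdj_swap_disjoint {k : V → ℕ} {E : Multiset (Sym2 V)} (hE : MLGspace k E)
    {u v x y : V} (hd : [u, v, x, y].Nodup) (h1 : s(u, v) ∈ E) (h2 : s(x, y) ∈ E)
    (h3 : s(u, x) ∉ E) (h4 : s(v, y) ∉ E) :
    ∃ E', GogAdj (MLGspace k) E E' ∧ nonloopCount E' = nonloopCount E ∧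
      ∀ a b, a ≠ b → (s(a, b) ∈ E' ↔ (s(a, b) ∈ E ∧ s(a, b) ≠ s(u, v) ∧ s(a, b) ≠ s(x, y)) ∨
        s(a, b) = s(u, x) ∨ s(a, b) = s(v, y)) := by
  simp only [List.nodup_cons, List.mem_cons, List.not_mem_nil, not_or, or_false] at hd
  obtain ⟨E', hadj, hN, hmem⟩ := exists_gogAdj_of_swap hE
    (pair_le_of_mem h1 h2 (by simp only [ne_eq, Sym2.eq_iff]; grind)) (fun _ => h3) (fun _ => h4)
    (by simp only [ne_eq, Sym2.eq_iff]; grind)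
  refine ⟨E', hadj, ?_, hmem⟩
  simp only [nonloopCount_pair, hd, if_false] at hN
  omega

end Moves

section Connectivity

variable [Fintype V] [DecidableEq V]

/-- No vertex lies on two non-loop edges. -/
def IsLoopyMatching (E : Multiset (Sym2 V)) : Prop :=
  ∀ u v x : V, u ≠ v → u ≠ x → s(u, v) ∈ E → s(u, x) ∈ E → v = x

theorem MLGspace.eq_add_card {k : V → ℕ} {E : Multiset (Sym2 V)} (hE : MLGspace k E) (u : V) :
    k u = 2 * E.count s(u, u) + (nonloopNeighbors E u).card := by
  rw [← hE.2 u, hE.1.mDeg_eq]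

theorem MLGspace.exists_nonloop_of_odd {k : V → ℕ} {E : Multiset (Sym2 V)} (hE : MLGspace k E)
    {u : V} (hu : Odd (k u)) : ∃ v, v ≠ u ∧ s(u, v) ∈ E := by
  by_contra! h
  have h0 : nonloopNeighbors E u = ∅ := by
    ext v
    simpa using h v
  have := hE.eq_add_card u
  rw [h0, Finset.card_empty] at this
  grind

theorem MLGspace.odd_of_matching {k : V → ℕ} {E : Multiset (Sym2 V)} (hE : MLGspace k E)
    (hM : IsLoopyMatching E) {u v : V} (huv : u ≠ v) (h : s(u, v) ∈ E) : Odd (k u) := by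
  have h0 : nonloopNeighbors E u = {v} := by
    ext w
    simp only [mem_nonloopNeighbors, Finset.mem_singleton]
    constructor
    · rintro ⟨hw, hm⟩
      exact hM u w v hw.symm huv hm h
    · rintro rfl
      exact ⟨huv.symm, h⟩
  have := hE.eq_add_card u
  rw [h0, Finset.card_singleton] at this
  grind

theorem MLGspace.ext {k : V → ℕ} {E E' : Multiset (Sym2 V)} (hE : MLGspace k E)
    (hE' : MLGspace k E') (h : ∀ a b, a ≠ b → (s(a, b) ∈ E ↔ s(a, b) ∈ E')) : E = E' := by
  ext e
  induction e with
  | h a b =>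
    by_cases hab : a = b
    · subst hab
      have hn : nonloopNeighbors E a = nonloopNeighbors E' a := by
        ext v
        simp only [mem_nonloopNeighbors]
        exact and_congr_right fun hv => h a v hv.symm
      have h1 := hE.eq_add_card a
      have h2 := hE'.eq_add_card a
      rw [hn] at h1
      omega
    · have h1 := hE.1 a b hab
      have h2 := hE'.1 a b hab
      have h3 := h a b hab
      rw [← Multiset.one_le_count_iff_mem, ← Multiset.one_le_count_iff_mem] at h3
      omega

/-- Number of non-loop adjacencies of `F` missing from `E`. -/
def missingCount (E F : Multiset (Sym2 V)) : ℕ :=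
  (Finset.univ.filter fun p : V × V => p.1 ≠ p.2 ∧ s(p.1, p.2) ∈ F ∧ s(p.1, p.2) ∉ E).card

theorem reachable_of_matchings {k : V → ℕ} {E F : Multiset (Sym2 V)} (hE : MLGspace k E)
    (hF : MLGspace k F) (hEM : IsLoopyMatching E) (hFM : IsLoopyMatching F) :
    Relation.ReflTransGen (GogAdj (MLGspace k)) E F := by
  induction hN : missingCount E F using Nat.strong_induction_on generalizing E with
  | _ N ih =>
  by_cases hsub : ∀ a b, a ≠ b → s(a, b) ∈ F → s(a, b) ∈ E
  · have : E = F := hE.ext hF fun a b hab => by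
      refine ⟨fun h => ?_, hsub a b hab⟩
      obtain ⟨c, hc, hac⟩ := hF.exists_nonloop_of_odd (hE.odd_of_matching hEM hab h)
      rwa [hEM a b c hab hc.symm h (hsub a c hc.symm hac)]
    rw [this]
  · push Not at hsub
    obtain ⟨a, b, hab, habF, habE⟩ := hsub
    obtain ⟨c, hca, hac⟩ := hE.exists_nonloop_of_odd (hF.odd_of_matching hFM hab habF)
    obtain ⟨d, hdb, hbd⟩ := hE.exists_nonloop_of_odd
      (hF.odd_of_matching hFM hab.symm (Sym2.eq_swap ▸ habF))
    have hswap : ∀ {p q : V} {G : Multiset (Sym2 V)}, s(p, q) ∈ G → s(q, p) ∈ G :=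
      fun h => Sym2.eq_swap ▸ h
    have hcb : c ≠ b := by
      rintro rfl
      exact habE hac
    have hda : d ≠ a := by
      rintro rfl
      exact habE (hswap hbd)
    have hcd : c ≠ d := by
      rintro rfl
      exact hab (hEM c a b hca hcb (hswap hac) (hswap hbd))
    have hcdE : s(c, d) ∉ E := fun h => hda (hEM c d a hcd hca h (hswap hac))
    obtain ⟨E', hadj, -, hmem⟩ := exists_gogAdj_swap_disjoint hE (u := a) (v := c) (x := b) (y := d)
      (by
        simp only [List.nodup_cons, List.mem_cons, List.not_mem_nil, not_or, or_false]
        grind) hac hbd habE hcdE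
    refine Relation.ReflTransGen.head hadj (ih _ ?_ hadj.2.1 ?_ rfl)
    · rw [← hN]
      refine Finset.card_lt_card (Finset.ssubset_iff_of_subset ?_ |>.2 ⟨(a, b), ?_, ?_⟩)
      · rintro ⟨p, q⟩ hpq
        simp only [Finset.mem_filter, Finset.mem_univ, true_and] at hpq ⊢
        obtain ⟨hne, hpF, hpE⟩ := hpq
        refine ⟨hne, hpF, fun hp => hpE ((hmem p q hne).2 (Or.inl ⟨hp, ?_, ?_⟩))⟩
        · intro h
          rw [h] at hpF
          exact hcb (hFM a c b hca.symm hab hpF habF)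
        · intro h
          rw [h] at hpF
          exact hda (hFM b d a hdb.symm hab.symm hpF (hswap habF))
      · simp [hab, habF, habE]
      · simp [(hmem a b hab).2 (Or.inr (Or.inl rfl))]
    · intro p q r hpq hpr hq hr
      have hs := fun p q => @hswap p q E
      have hM := hEM p
      rw [hmem p q hpq] at hq
      rw [hmem p r hpr] at hr
      have hMa := hEM a
      have hMb := hEM b
      have hMc := hEM c
      have hMd := hEM d
      simp only [Sym2.eq_iff, ne_eq] at hq hr
      grind

/-- Outside the two obstructed cases, a graph that is not a matching up to loops can be moved to
one with fewer non-loop edges. -/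
theorem exists_reachable_nonloopCount_lt {k : V → ℕ} (hk : ∀ u, 1 ≤ k u)
    (hodd : ∃ u, Odd (k u))
    (hfull : ∃ v, (k v : ℤ) - ((Fintype.card V : ℤ) - 1) < 0 ∨
      Odd ((k v : ℤ) - ((Fintype.card V : ℤ) - 1)))
    {E : Multiset (Sym2 V)} (hE : MLGspace k E) (hM : ¬ IsLoopyMatching E) :
    ∃ E', MLGspace k E' ∧ Relation.ReflTransGen (GogAdj (MLGspace k)) E E' ∧
      nonloopCount E' < nonloopCount E := by
  have hs : ∀ p q, s(p, q) ∈ E → s(q, p) ∈ E := fun p q h => Sym2.eq_swap ▸ h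
  by_cases hW : HasOpenWedge E
  · obtain ⟨u, v, x, huv, hux, hvx, h1, h2, h3⟩ := hW
    obtain ⟨E', hadj, hN, -⟩ := exists_gogAdj_close_wedge hE huv hux hvx h1 h2 h3
    exact ⟨E', hadj.2.1, .single hadj, by omega⟩
  have htrans : ∀ u v x, u ≠ v → u ≠ x → v ≠ x → s(u, v) ∈ E → s(u, x) ∈ E → s(v, x) ∈ E := by
    intro u v x h1 h2 h3 h4 h5
    by_contra h6
    exact hW ⟨u, v, x, h1, h2, h3, h4, h5, h6⟩
  simp only [IsLoopyMatching] at hM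
  push Not at hM
  obtain ⟨u, v, x, huv, hux, h1, h2, hvx⟩ := hM
  have h3 := htrans u v x huv hux hvx h1 h2
  by_cases hother : ∃ a b, a ≠ b ∧ s(a, b) ∈ E ∧ a ≠ u ∧ s(u, a) ∉ E
  · obtain ⟨a, b, hab, habE, hau, huaE⟩ := hother
    have hva : v ≠ a := by grind
    have hxa : x ≠ a := by grind
    have hbu : b ≠ u := by grind
    have hbv : b ≠ v := by grind
    have hvb : s(v, b) ∉ E := by grind
    have hxaE : s(x, a) ∉ E := by grind
    obtain ⟨E', hadj, hN, hmem⟩ := exists_gogAdj_swap_disjoint hE (u := u) (v := v) (x := a)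
      (y := b) (by
        simp only [List.nodup_cons, List.mem_cons, List.not_mem_nil, not_or, or_false]
        grind) h1 habE huaE hvb
    obtain ⟨E'', hadj', hN', -⟩ := exists_gogAdj_close_wedge hadj.2.1 hux hau.symm hxa
      ((hmem u x hux).2 (by simp only [Sym2.eq_iff, ne_eq]; grind))
      ((hmem u a hau.symm).2 (by simp))
      (fun h => by
        rw [hmem x a hxa] at h
        simp only [Sym2.eq_iff, ne_eq] at h
        grind)
    exact ⟨E'', hadj'.2.1, .head hadj (.single hadj'), by omega⟩
  push Not at hother
  by_cases hall : ∀ w, w ≠ u → s(u, w) ∈ E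
  · exfalso
    obtain ⟨w, hw⟩ := hfull
    have hn : nonloopNeighbors E w = Finset.univ.erase w := by
      ext z
      simp only [mem_nonloopNeighbors, Finset.mem_erase, Finset.mem_univ, and_true,
        and_iff_left_iff_imp]
      intro hz
      by_cases hwu : w = u
      · exact hwu ▸ hall z (hwu ▸ hz)
      · by_cases hzu : z = u
        · exact hs _ _ (hzu ▸ hall w hwu)
        · exact htrans u w z (Ne.symm hwu) (Ne.symm hzu) hz.symm (hall w hwu) (hall z hzu)
    have h := hE.eq_add_card w
    rw [hn, Finset.card_erase_of_mem (Finset.mem_univ w), Finset.card_univ] at h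
    have hpos : 0 < Fintype.card V := Fintype.card_pos_iff.2 ⟨w⟩
    have h' : (k w : ℤ) - ((Fintype.card V : ℤ) - 1) = 2 * (E.count s(w, w) : ℤ) := by omega
    rw [h'] at hw
    rcases hw with hw | ⟨m, hm⟩ <;> omega
  push Not at hall
  obtain ⟨w, hwu, hwE⟩ := hall
  have hiso : ∀ b, w ≠ b → s(w, b) ∉ E := fun b hb h => hwE (hother w b hb h hwu)
  have hloop : s(w, w) ∈ E := by
    have h0 : nonloopNeighbors E w = ∅ := by
      ext z
      simp only [mem_nonloopNeighbors, Finset.notMem_empty, iff_false, not_and]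
      exact fun hz => hiso z hz.symm
    have h := hE.eq_add_card w
    rw [h0, Finset.card_empty] at h
    have := hk w
    exact Multiset.one_le_count_iff_mem.1 (by omega)
  obtain ⟨o, ho⟩ := hodd
  have hcard : 2 < (nonloopNeighbors E o).card := by
    have h2 : 1 < (nonloopNeighbors E o).card := by
      obtain ⟨c, hc, hoc⟩ := hE.exists_nonloop_of_odd ho
      rw [Finset.one_lt_card_iff]
      simp only [mem_nonloopNeighbors]
      by_cases hou : o = u
      · subst hou
        exact ⟨v, x, ⟨huv.symm, h1⟩, ⟨hux.symm, h2⟩, hvx⟩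
      · have huo := hother o c hc.symm hoc hou
        by_cases hov : o = v
        · subst hov
          exact ⟨u, x, ⟨huv, hs _ _ h1⟩, ⟨hvx.symm, h3⟩, hux⟩
        · exact ⟨u, v, ⟨Ne.symm hou, hs _ _ huo⟩,
            ⟨Ne.symm hov, htrans u o v (Ne.symm hou) huv hov huo h1⟩, huv⟩
    have h := hE.eq_add_card o
    rcases ho with ⟨m, hm⟩
    omega
  obtain ⟨y, z, t, hy, hz, ht, hyz, hyt, hzt⟩ := Finset.two_lt_card_iff.1 hcard
  rw [mem_nonloopNeighbors] at hy hz ht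
  have hyt' := htrans o y t hy.1.symm ht.1.symm hyt hy.2 ht.2
  have hw : ∀ p q, p ≠ q → s(p, q) ∈ E → w ≠ p := by
    rintro p q hpq h rfl
    exact hiso q hpq h
  have hwo : w ≠ o := hw o y hy.1.symm hy.2
  have hwy : w ≠ y := hw y o hy.1 (hs _ _ hy.2)
  have hwz : w ≠ z := hw z o hz.1 (hs _ _ hz.2)
  have hwt : w ≠ t := hw t o ht.1 (hs _ _ ht.2)
  obtain ⟨E₁, hadj₁, hN₁, hmem₁⟩ := exists_gogAdj_open_loop hE hwo hwy hy.1.symm hloop hy.2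
    (hiso o hwo) (hiso y hwy)
  obtain ⟨E₂, hadj₂, hN₂, hmem₂⟩ := exists_gogAdj_close_wedge hadj₁.2.1 (u := o) (v := w) (x := z)
    hwo.symm hz.1.symm hwz
    ((hmem₁ o w hwo.symm).2 (by simp only [Sym2.eq_iff, ne_eq]; grind))
    ((hmem₁ o z hz.1.symm).2 (by simp only [Sym2.eq_iff, ne_eq]; grind))
    (fun h => by
      rw [hmem₁ w z hwz] at h
      simp only [Sym2.eq_iff, ne_eq] at h
      grind)
  obtain ⟨E₃, hadj₃, hN₃, -⟩ := exists_gogAdj_close_wedge hadj₂.2.1 (u := y) (v := w) (x := t)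
    hwy.symm hyt hwt
    ((hmem₂ y w hwy.symm).2 (by
      rw [hmem₁ y w hwy.symm]
      simp only [Sym2.eq_iff, ne_eq]
      grind))
    ((hmem₂ y t hyt).2 (by
      rw [hmem₁ y t hyt]
      simp only [Sym2.eq_iff, ne_eq]
      grind))
    (fun h => by
      rw [hmem₂ w t hwt, hmem₁ w t hwt] at h
      simp only [Sym2.eq_iff, ne_eq] at h
      grind)
  exact ⟨E₃, hadj₃.2.1, .head hadj₁ (.head hadj₂ (.single hadj₃)), by omega⟩

theorem exists_reachable_matching {k : V → ℕ} (hk : ∀ u, 1 ≤ k u)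
    (hodd : ∃ u, Odd (k u))
    (hfull : ∃ v, (k v : ℤ) - ((Fintype.card V : ℤ) - 1) < 0 ∨
      Odd ((k v : ℤ) - ((Fintype.card V : ℤ) - 1)))
    {E : Multiset (Sym2 V)} (hE : MLGspace k E) :
    ∃ E', MLGspace k E' ∧ Relation.ReflTransGen (GogAdj (MLGspace k)) E E' ∧
      IsLoopyMatching E' := by
  induction hN : nonloopCount E using Nat.strong_induction_on generalizing E with
  | _ N ih =>
  by_cases hM : IsLoopyMatching E
  · exact ⟨E, hE, .refl, hM⟩
  · obtain ⟨E', hE', hr, hlt⟩ := exists_reachable_nonloopCount_lt hk hodd hfull hE hM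
    obtain ⟨E'', hE'', hr', hM'⟩ := ih _ (hN ▸ hlt) hE' rfl
    exact ⟨E'', hE'', hr.trans hr', hM'⟩

end Connectivity

section Obstructions

variable [DecidableEq V]

theorem not_connected_of_isolated {P : Multiset (Sym2 V) → Prop} {E₀ : Multiset (Sym2 V)}
    (h₀ : P E₀) (hiso : ∀ E', GogAdj P E₀ E' → E' = E₀)
    (htwo : ∃ E E' : Multiset (Sym2 V), P E ∧ P E' ∧ E ≠ E') :
    ¬ ∀ E E' : Multiset (Sym2 V), P E → P E' → Relation.ReflTransGen (GogAdj P) E E' := by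
  intro hconn
  have heq : ∀ E, P E → E = E₀ := by
    intro E hE
    induction hconn E₀ E h₀ hE with
    | refl => rfl
    | tail _ hadj ih =>
      have := ih hadj.1
      subst this
      exact hiso _ hadj
  obtain ⟨E, E', hE, hE', hne⟩ := htwo
  exact hne ((heq E hE).trans (heq E' hE').symm)

theorem eq_of_gogAdj_of_no_nonloop {k : V → ℕ} {E E' : Multiset (Sym2 V)}
    (h0 : ∀ a b, a ≠ b → s(a, b) ∉ E) (h : GogAdj (MLGspace k) E E') : E' = E := by
  obtain ⟨u, v, x, y, hle, rfl⟩ := h.doubleEdgeSwap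
  have huv : u = v := by
    by_contra hne
    exact h0 u v hne (Multiset.mem_of_le hle (by simp))
  have hxy : x = y := by
    by_contra hne
    exact h0 x y hne (Multiset.mem_of_le hle (by simp))
  subst huv hxy
  have hux : u = x := by
    by_contra hne
    have := h.2.1.1 u x hne
    simp [Multiset.insert_eq_cons] at this
  subst hux
  exact tsub_add_cancel_of_le hle

theorem eq_of_gogAdj_of_all_nonloop {k : V → ℕ} {E E' : Multiset (Sym2 V)}
    (h1 : ∀ a b, a ≠ b → s(a, b) ∈ E) (h : GogAdj (MLGspace k) E E') : E' = E := by
  obtain ⟨u, v, x, y, hle, rfl⟩ := h.doubleEdgeSwap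
  have hkey : ∀ a b, a ≠ b → s(a, b) ∈ ({s(u, x), s(v, y)} : Multiset (Sym2 V)) →
      s(a, b) = s(u, v) ∨ s(a, b) = s(x, y) := by
    intro a b hab hm
    by_contra! hne
    have hc := h.2.1.1 a b hab
    have hz : ({s(u, v), s(x, y)} : Multiset (Sym2 V)).count s(a, b) = 0 :=
      Multiset.count_eq_zero_of_notMem (by simp [hne])
    rw [Multiset.count_add, Multiset.count_sub, hz] at hc
    have := Multiset.one_le_count_iff_mem.2 (h1 a b hab)
    have := Multiset.one_le_count_iff_mem.2 hm
    omega
  have hcancel : ({s(u, x), s(v, y)} : Multiset (Sym2 V)) = {s(u, v), s(x, y)} →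
      E - {s(u, v), s(x, y)} + {s(u, x), s(v, y)} = E := fun he => by
    rw [he, tsub_add_cancel_of_le hle]
  apply hcancel
  have hcases : v = x ∨ y = u ∨ (u = x ∧ v = y) := by
    have hu : u ≠ x → _ := fun hne => hkey u x hne (by simp)
    have hv : v ≠ y → _ := fun hne => hkey v y hne (by simp)
    simp only [Sym2.eq_iff] at hu hv
    grind
  rcases hcases with rfl | rfl | ⟨rfl, rfl⟩
  · rfl
  · rw [Sym2.eq_swap (a := x), Multiset.pair_comm, Sym2.eq_swap (a := v)]
  · have huv : u = v := by
      by_contra hne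
      have := h.1.1 u v hne
      have h2 := Multiset.le_iff_count.1 hle s(u, v)
      simp [Multiset.insert_eq_cons] at h2
      omega
    rw [huv]

variable [Fintype V]

/-- The graph with non-loop edges `S` and `c u` loops at each `u`. -/
def withLoops (S : Finset (Sym2 V)) (c : V → ℕ) : Multiset (Sym2 V) :=
  S.val + ∑ u, Multiset.replicate (c u) s(u, u)

theorem count_withLoops_of_ne (S : Finset (Sym2 V)) (c : V → ℕ) {a b : V} (hab : a ≠ b) :
    (withLoops S c).count s(a, b) = if s(a, b) ∈ S then 1 else 0 := by
  have h : ∀ u, s(u, u) ≠ s(a, b) := by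
    intro u
    simp only [ne_eq, Sym2.eq_iff]
    grind
  simp [withLoops, Multiset.count_sum', Multiset.count_replicate, h,
    Multiset.count_eq_of_nodup S.nodup]

theorem count_withLoops_self (S : Finset (Sym2 V)) (c : V → ℕ) {u : V} (hS : s(u, u) ∉ S) :
    (withLoops S c).count s(u, u) = c u := by
  have h : ∀ v, s(v, v) = s(u, u) ↔ v = u := by
    intro v
    simp only [Sym2.eq_iff]
    grind
  simp [withLoops, Multiset.count_sum', Multiset.count_replicate, h, hS]

theorem isMultiloopGraph_withLoops (S : Finset (Sym2 V)) (c : V → ℕ) :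
    IsMultiloopGraph (withLoops S c) := by
  intro a b hab
  rw [count_withLoops_of_ne S c hab]
  split_ifs <;> simp

theorem mem_withLoops_of_ne (S : Finset (Sym2 V)) (c : V → ℕ) {a b : V} (hab : a ≠ b) :
    s(a, b) ∈ withLoops S c ↔ s(a, b) ∈ S := by
  rw [← Multiset.one_le_count_iff_mem, count_withLoops_of_ne S c hab]
  split_ifs with h <;> simp [h]

theorem mlgSpace_loops_of_even {k : V → ℕ} (hk : ∀ u, Even (k u)) :
    MLGspace k (withLoops ∅ fun u => k u / 2) := by
  refine ⟨isMultiloopGraph_withLoops _ _, fun u => ?_⟩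
  have hn : nonloopNeighbors (withLoops ∅ fun u => k u / 2) u = ∅ := by
    ext v
    simp only [mem_nonloopNeighbors, Finset.notMem_empty, iff_false, not_and]
    intro hv
    simp [mem_withLoops_of_ne ∅ (fun u => k u / 2) hv.symm]
  rw [(isMultiloopGraph_withLoops _ _).mDeg_eq, hn, count_withLoops_self _ _ (by simp)]
  have := Nat.two_mul_div_two_of_even (hk u)
  simpa using this

theorem mlgSpace_complete {k c : V → ℕ} (hk : ∀ u, k u = 2 * c u + (Fintype.card V - 1)) :
    MLGspace k (withLoops (Finset.univ.filter fun e => ¬ e.IsDiag) c) := by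
  refine ⟨isMultiloopGraph_withLoops _ _, fun u => ?_⟩
  have hn : nonloopNeighbors (withLoops (Finset.univ.filter fun e => ¬ e.IsDiag) c) u =
      Finset.univ.erase u := by
    ext v
    simp only [mem_nonloopNeighbors, Finset.mem_erase, Finset.mem_univ, and_true,
      and_iff_left_iff_imp]
    intro hv
    simp [mem_withLoops_of_ne _ c hv.symm, hv.symm]
  rw [(isMultiloopGraph_withLoops _ _).mDeg_eq, hn, count_withLoops_self _ _ (by simp), hk u,
    Finset.card_erase_of_mem (Finset.mem_univ u), Finset.card_univ]

end Obstructions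

/-- for a degree sequence with all degrees at least 1 admitting at least two
distinct multiloop-graph realizations, the graph of multiloop-graphs is connected iff
(1) some degree is odd and (2) some `k v - (n - 1)` is negative or odd. -/
theorem multiloop_gog_connected_iff {V : Type*} [Fintype V] [DecidableEq V]
    (k : V → ℕ) (hk : ∀ u, 1 ≤ k u)
    (htwo : ∃ E E' : Multiset (Sym2 V), MLGspace k E ∧ MLGspace k E' ∧ E ≠ E') :
    (∀ E E' : Multiset (Sym2 V), MLGspace k E → MLGspace k E' →
        Relation.ReflTransGen (GogAdj (MLGspace k)) E E') ↔
      ((∃ u, Odd (k u)) ∧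
        (∃ v, (k v : ℤ) - ((Fintype.card V : ℤ) - 1) < 0 ∨
          Odd ((k v : ℤ) - ((Fintype.card V : ℤ) - 1)))) := by
  refine ⟨fun hconn => ⟨?_, ?_⟩, fun ⟨hodd, hfull⟩ E E' hE hE' => ?_⟩
  · by_contra! hodd
    refine not_connected_of_isolated
      (mlgSpace_loops_of_even fun u => Nat.not_odd_iff_even.1 (hodd u))
      (fun E' => eq_of_gogAdj_of_no_nonloop fun a b hab => ?_) htwo hconn
    simp [mem_withLoops_of_ne _ _ hab]
  · by_contra! hfull
    have hdeg : ∀ u, k u = 2 * ((k u - (Fintype.card V - 1)) / 2) + (Fintype.card V - 1) := by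
      intro u
      have hpos : 0 < Fintype.card V := Fintype.card_pos_iff.2 ⟨u⟩
      obtain ⟨h1, h2⟩ := hfull u
      obtain ⟨m, hm⟩ := Int.not_odd_iff_even.1 h2
      omega
    refine not_connected_of_isolated (mlgSpace_complete hdeg)
      (fun E' => eq_of_gogAdj_of_all_nonloop fun a b hab => ?_) htwo hconn
    simp [mem_withLoops_of_ne _ _ hab, hab]
  · obtain ⟨F, hF, hr, hM⟩ := exists_reachable_matching hk hodd hfull hE
    obtain ⟨F', hF', hr', hM'⟩ := exists_reachable_matching hk hodd hfull hE'
    exact (hr.trans (reachable_of_matchings hF hF' hM hM')).trans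
      (Relation.ReflTransGen.mono (fun _ _ h => GogAdj.symm h) _ _ hr'.swap)
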